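/- Define ξ_n = −2 Σ_{k=1}^n u_ε w ∂_k H_{nk} + 2 Σ_{i=1}^n ∂_i(u_ε w) H_{in} + (1/2) u_ε² Σ_{i,k=1}^n ∂_n S_{ik} H_{ik} − u_ε² Σ_{i,l=1}^n ∂_l S_{il} H_{in} − 2 u_ε Σ_{i,l=1}^n ∂_l u_ε S_{il} H_{in} + u_ε w Σ_{k=1}^n ∂_k S_{nk} − Σ_{i=1}^n ∂_i(u_ε w) S_{in} − (1/4) u_ε² Σ_{i,k=1}^n ∂_n S_{ik} S_{ik} + (1/2) u_ε² Σ_{i,l=1}^n ∂_l S_{il} S_{in} + u_ε Σ_{i,l=1}^n ∂_l u_ε S_{il} S_{in} + (4(n−1)/(n−2)) Σ_{i=1}^n ∂_i u_ε w S_{in} − (4(n−1)/(n−2)) w ∂_n w + (2/(n−2)) u_ε Σ_{i,k=1}^n ∂_k u_ε T_{ik} T_{in}. Then ξ_n(x) = 0 for all points x ∈ B_δ(0) ∩ ∂ℝ^n_+. -/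

import Mathlib

noncomputable section

open MeasureTheory Metric

/-- Euclidean space `ℝ^n`. -/
abbrev Euc (n : ℕ) := EuclideanSpace ℝ (Fin n)

/-- Partial derivative in the `i`-th coordinate direction. -/
def pd {n : ℕ} (i : Fin n) (f : Euc n → ℝ) : Euc n → ℝ :=
  fun x => fderiv ℝ f x (EuclideanSpace.single i 1)

/-- Kronecker delta. -/
def kd {n : ℕ} (i k : Fin n) : ℝ := if i = k then 1 else 0

/-- The finite set of multi-indices `α` with `2 ≤ |α| ≤ d`. -/
def MIdx (n d : ℕ) : Finset (Fin n → ℕ) :=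
  (Fintype.piFinset fun _ : Fin n => Finset.range (d + 1)).filter
    fun α => 2 ≤ ∑ i, α i ∧ ∑ i, α i ≤ d

/-- The standard bubble `u_ε(x) = (ε/(ε² + |x|²))^{(n-2)/2}`. -/
def uE (n : ℕ) (ε : ℝ) : Euc n → ℝ :=
  fun x => (ε / (ε ^ 2 + ‖x‖ ^ 2)) ^ (((n : ℝ) - 2) / 2)

/-- `S_{ik} = ∂_i V_k + ∂_k V_i - (2/n) (div V) δ_{ik}`. -/
def Sop {n : ℕ} (V : Fin n → Euc n → ℝ) (i k : Fin n) : Euc n → ℝ :=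
  fun x => pd i (V k) x + pd k (V i) x - (2 / (n : ℝ)) * (∑ m, pd m (V m) x) * kd i k

/-- `T_{ik} = H_{ik} - S_{ik}`. -/
def Tten {n : ℕ} (H : Fin n → Fin n → Euc n → ℝ) (V : Fin n → Euc n → ℝ) (i k : Fin n) :
    Euc n → ℝ :=
  fun x => H i k x - Sop V i k x

/-- The tensor `Q_{ik,l}`. -/
def Qop {n : ℕ} (ε : ℝ) (H : Fin n → Fin n → Euc n → ℝ) (V : Fin n → Euc n → ℝ)
    (i k l : Fin n) : Euc n → ℝ :=
  fun x =>
    uE n ε x * pd l (Tten H V i k) x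
      - (2 / ((n : ℝ) - 2)) * pd i (uE n ε) x * Tten H V k l x
      - (2 / ((n : ℝ) - 2)) * pd k (uE n ε) x * Tten H V i l x
      + (2 / ((n : ℝ) - 2)) * (∑ p, pd p (uE n ε) x * Tten H V i p x) * kd k l
      + (2 / ((n : ℝ) - 2)) * (∑ p, pd p (uE n ε) x * Tten H V k p x) * kd i l

/-- The function `w = Σ_l ∂_l u_ε V_l + ((n-2)/(2n)) u_ε div V`. -/
def wop {n : ℕ} (ε : ℝ) (V : Fin n → Euc n → ℝ) : Euc n → ℝ :=
  fun x => (∑ l, pd l (uE n ε) x * V l x)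
    + (((n : ℝ) - 2) / (2 * (n : ℝ))) * uE n ε x * (∑ l, pd l (V l) x)


lemma pd_line {n : ℕ} (i : Fin n) (f : Euc n → ℝ) (x : Euc n) (hf : DifferentiableAt ℝ f x) :
    HasDerivAt (fun t : ℝ => f (x + t • EuclideanSpace.single i (1 : ℝ))) (pd i f x) 0 := by
  have := hf.hasFDerivAt.hasLineDerivAt (EuclideanSpace.single i (1 : ℝ))
  exact this

lemma pd_tang {n : ℕ} (l₀ i : Fin n) (hi : i ≠ l₀) (f : Euc n → ℝ)
    (hf : ∀ y : Euc n, y l₀ = 0 → f y = 0) (x : Euc n) (hx : x l₀ = 0) : pd i f x = 0 := by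
  by_cases hd : DifferentiableAt ℝ f x
  · have h1 := pd_line i f x hd
    have h2 : (fun t : ℝ => f (x + t • EuclideanSpace.single i (1 : ℝ))) = fun _ => 0 := by
      funext t
      apply hf
      simp [hx, hi.symm]
    rw [h2] at h1
    exact h1.unique (hasDerivAt_const _ _)
  · simp [pd, fderiv_zero_of_not_differentiableAt hd]

lemma pd_even {n : ℕ} (l₀ : Fin n) (f : Euc n → ℝ)
    (hf : ∀ y z : Euc n, ‖y‖ = ‖z‖ → f y = f z) (x : Euc n) (hx : x l₀ = 0) :
    pd l₀ f x = 0 := by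
  by_cases hd : DifferentiableAt ℝ f x
  · have h1 := pd_line l₀ f x hd
    have h2 : ∀ t : ℝ, f (x + (-t) • EuclideanSpace.single l₀ (1 : ℝ))
        = f (x + t • EuclideanSpace.single l₀ (1 : ℝ)) := by
      intro t
      apply hf
      rw [EuclideanSpace.norm_eq, EuclideanSpace.norm_eq]
      congr 1
      apply Finset.sum_congr rfl
      intro j _
      by_cases hj : j = l₀
      · subst hj; simp [hx]
      · simp [hj]
    have h3 : HasDerivAt (fun t : ℝ => f (x + (-t) • EuclideanSpace.single l₀ (1 : ℝ)))
        (-(pd l₀ f x)) 0 := by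
      have h1' : HasDerivAt (fun t : ℝ => f (x + t • EuclideanSpace.single l₀ (1 : ℝ)))
        (pd l₀ f x) (-0) := by simpa using h1
      have := h1'.scomp (0 : ℝ) (hasDerivAt_neg (0 : ℝ))
      simpa [Function.comp_def] using this
    simp only [h2] at h3
    have := h1.unique h3
    linarith
  · simp [pd, fderiv_zero_of_not_differentiableAt hd]

lemma pd_add' {n : ℕ} (i : Fin n) {f g : Euc n → ℝ} (hf : Differentiable ℝ f)
    (hg : Differentiable ℝ g) (x : Euc n) :
    pd i (fun y => f y + g y) x = pd i f x + pd i g x := by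
  simp [pd, fderiv_fun_add (hf x) (hg x)]

lemma pd_sub' {n : ℕ} (i : Fin n) {f g : Euc n → ℝ} (hf : Differentiable ℝ f)
    (hg : Differentiable ℝ g) (x : Euc n) :
    pd i (fun y => f y - g y) x = pd i f x - pd i g x := by
  simp [pd, fderiv_fun_sub (hf x) (hg x)]

lemma pd_mul' {n : ℕ} (i : Fin n) {f g : Euc n → ℝ} (hf : Differentiable ℝ f)
    (hg : Differentiable ℝ g) (x : Euc n) :
    pd i (fun y => f y * g y) x = f x * pd i g x + g x * pd i f x := by
  simp [pd, fderiv_fun_mul (hf x) (hg x)]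

lemma pd_const' {n : ℕ} (i : Fin n) (c : ℝ) (x : Euc n) : pd i (fun _ => c) x = 0 := by
  simp [pd]

lemma pd_sum' {n : ℕ} (i : Fin n) {f : Fin n → Euc n → ℝ} (hf : ∀ m, Differentiable ℝ (f m))
    (x : Euc n) : pd i (fun y => ∑ m, f m y) x = ∑ m, pd i (f m) x := by
  simp only [pd]
  rw [fderiv_fun_sum (fun m _ => hf m x)]
  simp

lemma pd_smooth {n : ℕ} (i : Fin n) {f : Euc n → ℝ} (hf : ContDiff ℝ (⊤ : ℕ∞) f) :
    ContDiff ℝ (⊤ : ℕ∞) (pd i f) := by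
  have : ContDiff ℝ (⊤ : ℕ∞) (fderiv ℝ f) := hf.fderiv_right (by simp)
  exact this.clm_apply contDiff_const

lemma sm_diff {n : ℕ} {f : Euc n → ℝ} (hf : ContDiff ℝ (⊤ : ℕ∞) f) : Differentiable ℝ f :=
  hf.differentiable (by simp)

lemma pd_comm' {n : ℕ} (i j : Fin n) {f : Euc n → ℝ} (hf : ContDiff ℝ (⊤ : ℕ∞) f) (x : Euc n) :
    pd i (pd j f) x = pd j (pd i f) x := by
  have h1 : ContDiff ℝ (⊤ : ℕ∞) (fderiv ℝ f) := hf.fderiv_right (by simp)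
  have h2 : DifferentiableAt ℝ (fderiv ℝ f) x := (h1.differentiable (by simp)) x
  have hs : IsSymmSndFDerivAt ℝ f x :=
    hf.contDiffAt.isSymmSndFDerivAt (by simp; exact WithTop.coe_le_coe.2 (le_top : (2 : ℕ∞) ≤ ⊤))
  have key : ∀ a b : Fin n, pd a (pd b f) x
      = fderiv ℝ (fderiv ℝ f) x (EuclideanSpace.single a 1) (EuclideanSpace.single b 1) := by
    intro a b
    unfold pd
    rw [fderiv_clm_apply h2 (differentiableAt_const _)]
    simp
  rw [key, key]
  exact hs _ _

lemma base_pos {n : ℕ} (ε : ℝ) (hε : 0 < ε) (x : Euc n) : 0 < ε / (ε ^ 2 + ‖x‖ ^ 2) := by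
  positivity

lemma uE_smooth (n : ℕ) (ε : ℝ) (hε : 0 < ε) : ContDiff ℝ (⊤ : ℕ∞) (uE n ε) := by
  unfold uE
  apply ContDiff.rpow_const_of_ne
  · apply ContDiff.div contDiff_const
    · exact contDiff_const.add (contDiff_norm_sq ℝ)
    · intro x; positivity
  · intro x; exact (base_pos ε hε x).ne'

lemma uE_pos (n : ℕ) (ε : ℝ) (hε : 0 < ε) (x : Euc n) : 0 < uE n ε x :=
  Real.rpow_pos_of_pos (base_pos ε hε x) _

lemma uE_rad (n : ℕ) (ε : ℝ) (y z : Euc n) (h : ‖y‖ = ‖z‖) : uE n ε y = uE n ε z := by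
  simp [uE, h]

/-- the normal component `ξ_n` of Brendle's vector field `ξ` vanishes on
`B_δ(0) ∩ ∂ℝ^n_+`. -/
theorem statement9 (n : ℕ) (hn : 6 ≤ n) (l₀ : Fin n) (hl₀ : (l₀ : ℕ) = n - 1)
    (d : ℕ) (hd : d = (n - 2) / 2)
    (h : Fin n → Fin n → (Fin n → ℕ) → ℝ)
    (H : Fin n → Fin n → Euc n → ℝ)
    (hHdef : ∀ i k x, H i k x = ∑ α ∈ MIdx n d, h i k α * ∏ m, x m ^ α m)
    (hsymm : ∀ i k x, H i k x = H k i x)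
    (htrace : ∀ x, ∑ i, H i i x = 0)
    (hH1 : ∀ x : Euc n, 0 ≤ x l₀ → ∀ i, H i l₀ x = 0)
    (hH2 : ∀ x : Euc n, x l₀ = 0 → ∀ i, ∑ k, H i k x * x k = 0)
    (hH3 : ∀ x : Euc n, x l₀ = 0 → ∀ i k, pd l₀ (H i k) x = 0)
    (ε : ℝ) (hε : 0 < ε) (δ : ℝ) (hδ : 0 < δ)
    (V : Fin n → Euc n → ℝ) (hV : ∀ i, ContDiff ℝ (⊤ : ℕ∞) (V i))
    (hVb1 : ∀ x : Euc n, x l₀ = 0 → V l₀ x = 0)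
    (hVb2 : ∀ x : Euc n, x l₀ = 0 → ∀ i, i ≠ l₀ → pd l₀ (V i) x = 0)
    (hdiv : ∀ x ∈ Metric.ball (0 : Euc n) δ, 0 ≤ x l₀ → ∀ i,
      ∑ k, pd k (fun y => uE n ε y ^ (2 * (n : ℝ) / ((n : ℝ) - 2)) * Tten H V i k y) x = 0)
    (ξn : Euc n → ℝ)
    (hξ : ∀ x : Euc n, ξn x =
      -2 * (∑ k, uE n ε x * wop ε V x * pd k (H l₀ k) x)
      + 2 * (∑ i, pd i (fun y => uE n ε y * wop ε V y) x * H i l₀ x)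
      + (1 / 2) * uE n ε x ^ 2 * (∑ i, ∑ k, pd l₀ (Sop V i k) x * H i k x)
      - uE n ε x ^ 2 * (∑ i, ∑ l, pd l (Sop V i l) x * H i l₀ x)
      - 2 * uE n ε x * (∑ i, ∑ l, pd l (uE n ε) x * Sop V i l x * H i l₀ x)
      + uE n ε x * wop ε V x * (∑ k, pd k (Sop V l₀ k) x)
      - (∑ i, pd i (fun y => uE n ε y * wop ε V y) x * Sop V i l₀ x)
      - (1 / 4) * uE n ε x ^ 2 * (∑ i, ∑ k, pd l₀ (Sop V i k) x * Sop V i k x)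
      + (1 / 2) * uE n ε x ^ 2 * (∑ i, ∑ l, pd l (Sop V i l) x * Sop V i l₀ x)
      + uE n ε x * (∑ i, ∑ l, pd l (uE n ε) x * Sop V i l x * Sop V i l₀ x)
      + (4 * ((n : ℝ) - 1) / ((n : ℝ) - 2))
        * (∑ i, pd i (uE n ε) x * wop ε V x * Sop V i l₀ x)
      - (4 * ((n : ℝ) - 1) / ((n : ℝ) - 2)) * wop ε V x * pd l₀ (wop ε V) x
      + (2 / ((n : ℝ) - 2)) * uE n ε x
        * (∑ i, ∑ k, pd k (uE n ε) x * Tten H V i k x * Tten H V i l₀ x)) :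
    ∀ x ∈ Metric.ball (0 : Euc n) δ, x l₀ = 0 → ξn x = 0 := by
  intro x hxb hx0
  have hn0 : (n : ℝ) ≠ 0 := by positivity
  have hn6 : (6 : ℝ) ≤ n := by exact_mod_cast hn
  have hVp : ∀ i k, ContDiff ℝ (⊤ : ℕ∞) (pd i (V k)) := fun i k => pd_smooth i (hV k)
  have hDs : ContDiff ℝ (⊤ : ℕ∞) (fun y => ∑ m, pd m (V m) y) :=
    ContDiff.sum fun m _ => hVp m m
  have hu := uE_smooth n ε hε
  have hSs : ∀ i k, ContDiff ℝ (⊤ : ℕ∞) (Sop V i k) := fun i k =>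
    ((hVp i k).add (hVp k i)).sub ((contDiff_const.mul hDs).mul contDiff_const)
  have hHs : ∀ i k, ContDiff ℝ (⊤ : ℕ∞) (H i k) := by
    intro i k
    have : H i k = fun x => ∑ α ∈ MIdx n d, h i k α * ∏ m, x m ^ α m := funext (hHdef i k)
    rw [this]
    fun_prop
  have hws : ContDiff ℝ (⊤ : ℕ∞) (wop ε V) :=
    (ContDiff.sum fun l _ => (pd_smooth l hu).mul (hV l)).add ((contDiff_const.mul hu).mul hDs)
  have hTs : ∀ i k, ContDiff ℝ (⊤ : ℕ∞) (Tten H V i k) := fun i k => (hHs i k).sub (hSs i k)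
  -- boundary facts
  have hun : ∀ y : Euc n, y l₀ = 0 → pd l₀ (uE n ε) y = 0 := fun y hy =>
    pd_even l₀ _ (uE_rad n ε) y hy
  have hH0 : ∀ y : Euc n, y l₀ = 0 → ∀ i, H i l₀ y = 0 := fun y hy i => hH1 y hy.ge i
  have hH0' : ∀ y : Euc n, y l₀ = 0 → ∀ i, H l₀ i y = 0 := fun y hy i => by
    rw [hsymm]; exact hH0 y hy i
  have hdH : ∀ k, pd k (H l₀ k) x = 0 := by
    intro k
    by_cases hk : k = l₀
    · subst hk; exact hH3 x hx0 _ _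
    · exact pd_tang l₀ k hk _ (fun y hy => hH0' y hy k) x hx0
  have hS0 : ∀ y : Euc n, y l₀ = 0 → ∀ i, i ≠ l₀ → Sop V i l₀ y = 0 := by
    intro y hy i hi
    simp [Sop, kd, hi, hVb2 y hy i hi, pd_tang l₀ i hi _ hVb1 y hy]
  have hSsym : ∀ i k y, Sop V i k y = Sop V k i y := by
    intro i k y
    simp only [Sop, kd, eq_comm (a := i) (b := k)]
    ring
  have hS0' : ∀ y : Euc n, y l₀ = 0 → ∀ i, i ≠ l₀ → Sop V l₀ i y = 0 := by
    intro y hy i hi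
    rw [hSsym]; exact hS0 y hy i hi
  have hVt : ∀ i k, k ≠ l₀ → i ≠ l₀ → pd l₀ (pd i (V k)) x = 0 := by
    intro i k hk hi
    rw [pd_comm' l₀ i (hV k)]
    exact pd_tang l₀ i hi _ (fun y hy => hVb2 y hy k hk) x hx0
  have hD1 : pd l₀ (fun y => ∑ m, pd m (V m) y) x = pd l₀ (pd l₀ (V l₀)) x := by
    rw [pd_sum' l₀ (fun m => sm_diff (hVp m m))]
    exact Finset.sum_eq_single l₀ (fun m _ hm => hVt m m hm hm) (by simp)
  have hdS : ∀ i k, pd l₀ (Sop V i k) x = pd l₀ (pd i (V k)) x + pd l₀ (pd k (V i)) x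
      - (2 / (n : ℝ)) * pd l₀ (pd l₀ (V l₀)) x * kd i k := by
    intro i k
    have e : Sop V i k = fun x => (pd i (V k) x + pd k (V i) x)
      - ((2 / (n : ℝ)) * kd i k) * (∑ m, pd m (V m) x) := by
      funext y; simp only [Sop]; ring
    rw [e, pd_sub' l₀ (sm_diff ((hVp i k).add (hVp k i))) (sm_diff (contDiff_const.mul hDs)),
      pd_add' l₀ (sm_diff (hVp i k)) (sm_diff (hVp k i)),
      pd_mul' l₀ (sm_diff contDiff_const) (sm_diff hDs), pd_const', hD1]
    ring
  -- the divergence condition gives the vanishing of the second normal derivative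
  have ha : pd l₀ (pd l₀ (V l₀)) x = 0 := by
    have h1 := hdiv x hxb hx0.ge l₀
    have hups : ContDiff ℝ (⊤ : ℕ∞) (fun y => uE n ε y ^ (2 * (n : ℝ) / ((n : ℝ) - 2))) :=
      hu.rpow_const_of_ne fun y => (uE_pos n ε hε y).ne'
    rw [Finset.sum_eq_single l₀] at h1
    · rw [pd_mul' l₀ (sm_diff hups) (sm_diff (hTs l₀ l₀)),
        pd_even l₀ (fun y => uE n ε y ^ (2 * (n : ℝ) / ((n : ℝ) - 2)))
          (fun y z hyz => by simp only [uE_rad n ε y z hyz]) x hx0] at h1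
      have hpos : 0 < uE n ε x ^ (2 * (n : ℝ) / ((n : ℝ) - 2)) :=
        Real.rpow_pos_of_pos (uE_pos n ε hε x) _
      have h2 : pd l₀ (Tten H V l₀ l₀) x = 0 := by
        have : uE n ε x ^ (2 * (n : ℝ) / ((n : ℝ) - 2)) * pd l₀ (Tten H V l₀ l₀) x = 0 := by
          linarith
        exact (mul_eq_zero.mp this).resolve_left hpos.ne'
      have e : Tten H V l₀ l₀ = fun y => H l₀ l₀ y - Sop V l₀ l₀ y := rfl
      rw [e, pd_sub' l₀ (sm_diff (hHs _ _)) (sm_diff (hSs _ _)), hH3 x hx0, hdS] at h2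
      simp only [kd, if_true] at h2
      have h3 : (2 - 2 / (n : ℝ)) * pd l₀ (pd l₀ (V l₀)) x = 0 := by linarith
      refine (mul_eq_zero.mp h3).resolve_left ?_
      have : (2 : ℝ) / n < 2 := by
        rw [div_lt_iff₀ (by linarith)]; linarith
      linarith
    · intro k _ hk
      apply pd_tang l₀ k hk _ _ x hx0
      intro y hy
      simp [Tten, hH0' y hy k, hS0' y hy k hk]
    · simp
  have hdSt : ∀ i k, i ≠ l₀ → k ≠ l₀ → pd l₀ (Sop V i k) x = 0 := by
    intro i k hi hk
    rw [hdS, ha, hVt i k hk hi, hVt k i hi hk]; ring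
  have hdSn : pd l₀ (Sop V l₀ l₀) x = 0 := by
    rw [hdS, ha]; ring
  have hdivS : ∀ k, pd k (Sop V l₀ k) x = 0 := by
    intro k
    by_cases hk : k = l₀
    · subst hk; exact hdSn
    · exact pd_tang l₀ k hk _ (fun y hy => hS0' y hy k hk) x hx0
  have hw : pd l₀ (wop ε V) x = 0 := by
    have e : wop ε V = fun x => (∑ l, pd l (uE n ε) x * V l x)
      + ((((n : ℝ) - 2) / (2 * (n : ℝ))) * uE n ε x) * (∑ l, pd l (V l) x) := rfl
    rw [e, pd_add' l₀
        (sm_diff (ContDiff.sum fun l _ => (pd_smooth l hu).mul (hV l)))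
        (sm_diff ((contDiff_const.mul hu).mul hDs)),
      pd_sum' l₀ (fun l => sm_diff ((pd_smooth l hu).mul (hV l))),
      pd_mul' l₀ (sm_diff (contDiff_const.mul hu)) (sm_diff hDs),
      pd_mul' l₀ (sm_diff contDiff_const) (sm_diff hu), pd_const', hD1, ha, hun x hx0,
      Finset.sum_eq_zero]
    · simp
    · intro l _
      rw [pd_mul' l₀ (sm_diff (pd_smooth l hu)) (sm_diff (hV l))]
      by_cases hl : l = l₀
      · subst hl; rw [hun x hx0, hVb1 x hx0]; ring
      · rw [hVb2 x hx0 l hl, pd_comm' l₀ l hu, pd_tang l₀ l hl _ hun x hx0]; ring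
  have huw : pd l₀ (fun y => uE n ε y * wop ε V y) x = 0 := by
    rw [pd_mul' l₀ (sm_diff hu) (sm_diff hws), hw, hun x hx0]; ring
  have t1 : ∀ i k, pd l₀ (Sop V i k) x * H i k x = 0 := by
    intro i k
    by_cases hi : i = l₀
    · subst hi; rw [hH0' x hx0]; ring
    by_cases hk : k = l₀
    · subst hk; rw [hH0 x hx0]; ring
    rw [hdSt i k hi hk]; ring
  have t2 : ∀ i k, pd l₀ (Sop V i k) x * Sop V i k x = 0 := by
    intro i k
    by_cases hi : i = l₀
    · by_cases hk : k = l₀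
      · rw [hi, hk, hdSn]; ring
      · rw [hi, hS0' x hx0 k hk]; ring
    by_cases hk : k = l₀
    · rw [hk, hS0 x hx0 i hi]; ring
    rw [hdSt i k hi hk]; ring
  have t3 : ∀ i, pd i (fun y => uE n ε y * wop ε V y) x * Sop V i l₀ x = 0 := by
    intro i
    by_cases hi : i = l₀
    · rw [hi, huw]; ring
    · rw [hS0 x hx0 i hi]; ring
  have t4 : ∀ i l, pd l (Sop V i l) x * Sop V i l₀ x = 0 := by
    intro i l
    by_cases hi : i = l₀
    · rw [hi, hdivS]; ring
    · rw [hS0 x hx0 i hi]; ring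
  have t5 : ∀ i l, pd l (uE n ε) x * Sop V i l x * Sop V i l₀ x = 0 := by
    intro i l
    by_cases hi : i = l₀
    · by_cases hl : l = l₀
      · rw [hl, hun x hx0]; ring
      · rw [hi, hS0' x hx0 l hl]; ring
    · rw [hS0 x hx0 i hi]; ring
  have t6 : ∀ i, pd i (uE n ε) x * wop ε V x * Sop V i l₀ x = 0 := by
    intro i
    by_cases hi : i = l₀
    · rw [hi, hun x hx0]; ring
    · rw [hS0 x hx0 i hi]; ring
  have t7 : ∀ i k, pd k (uE n ε) x * Tten H V i k x * Tten H V i l₀ x = 0 := by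
    intro i k
    by_cases hi : i = l₀
    · by_cases hl : k = l₀
      · rw [hl, hun x hx0]; ring
      · simp [hi, Tten, hS0' x hx0 k hl, hH0' x hx0 k]
    · simp [Tten, hS0 x hx0 i hi, hH0 x hx0 i]
  rw [hξ]
  simp only [t1, t2, t3, t4, t5, t6, t7, hdH, hdivS, hH0 x hx0, hw, mul_zero,
    Finset.sum_const_zero, add_zero, sub_zero]
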